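/- Let D and D' be division rings, m, n, m', n' ≥ 2, and let φ: D^{m×n} → D'^{m'×n'} be a map with φ(0) = 0 that preserves distances 1 and 2, i.e., rank(X − Y) = 1 implies rank(φ(X) − φ(Y)) = 1 and rank(X − Y) = 2 implies rank(φ(X) − φ(Y)) = 2. Suppose M and N are two distinct maximal sets in D^{m×n} of the same type (resp. of different types) with 0 ∈ M and M ∩ N ≠ ∅. Then there exist two distinct maximal sets M' and N' in D'^{m'×n'} of the same type (resp. of different types) such that φ(M) ⊆ M' and φ(N) ⊆ N'. -/

import Mathlib

open Matrix

/-- Rank of a matrix over a division ring: dimension of the left row space. -/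
noncomputable def mrank {D : Type} [DivisionRing D] {m n : ℕ} (A : Matrix (Fin m) (Fin n) D) : ℕ :=
  Module.finrank D (Submodule.span D (Set.range fun i : Fin m => fun j : Fin n => A i j))

/-- The standard maximal set of type one: matrices whose rows other than the first are zero. -/
def M1set (D : Type) [DivisionRing D] (m n : ℕ) : Set (Matrix (Fin m) (Fin n) D) :=
  {X | ∀ i j, i.val ≠ 0 → X i j = 0}

/-- The standard maximal set of type two: matrices whose columns other than the first are zero. -/
def N1set (D : Type) [DivisionRing D] (m n : ℕ) : Set (Matrix (Fin m) (Fin n) D) :=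
  {X | ∀ i j, j.val ≠ 0 → X i j = 0}

/-- A maximal set of type one: a set of the form `P·M₁ + A` with `P` invertible. -/
def IsTypeOne {D : Type} [DivisionRing D] {m n : ℕ} (S : Set (Matrix (Fin m) (Fin n) D)) : Prop :=
  ∃ P : Matrix (Fin m) (Fin m) D, ∃ A : Matrix (Fin m) (Fin n) D,
    IsUnit P ∧ S = (fun X => P * X + A) '' M1set D m n

/-- A maximal set of type two: a set of the form `N₁·Q + A` with `Q` invertible. -/
def IsTypeTwo {D : Type} [DivisionRing D] {m n : ℕ} (S : Set (Matrix (Fin m) (Fin n) D)) : Prop :=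
  ∃ Q : Matrix (Fin n) (Fin n) D, ∃ A : Matrix (Fin m) (Fin n) D,
    IsUnit Q ∧ S = (fun X => X * Q + A) '' N1set D m n

section

variable {D : Type} [DivisionRing D] {m n : ℕ}

/-- A matrix has rank at most one exactly when it is a column times a row. -/
lemma mrank_le_one_iff {A : Matrix (Fin m) (Fin n) D} :
    mrank A ≤ 1 ↔ ∃ x y, A = vecMulVec x y := by
  constructor
  · intro h
    obtain ⟨v, hv⟩ := finrank_le_one_iff.1 h
    choose x hx using fun i =>
      hv ⟨fun j => A i j, Submodule.subset_span (Set.mem_range_self i)⟩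
    refine ⟨x, v, ?_⟩
    ext i j
    have := congrFun (congrArg Subtype.val (hx i)) j
    simpa [vecMulVec_apply] using this.symm
  · rintro ⟨x, y, rfl⟩
    refine (Submodule.finrank_mono (t := Submodule.span D {y}) ?_).trans
      ((finrank_span_le_card {y}).trans (by simp))
    rw [Submodule.span_le]
    rintro _ ⟨i, rfl⟩
    exact Submodule.mem_span_singleton.2 ⟨x i, rfl⟩

lemma mrank_eq_zero_iff {A : Matrix (Fin m) (Fin n) D} : mrank A = 0 ↔ A = 0 := by
  rw [mrank, Submodule.finrank_eq_zero, Submodule.span_eq_bot]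
  constructor
  · intro h
    ext i j
    exact congrFun (h _ (Set.mem_range_self i)) j
  · rintro rfl _ ⟨i, rfl⟩
    rfl

lemma mrank_vecMulVec_sub_le (x z : Fin m → D) (y w : Fin n → D) :
    mrank (vecMulVec x y - vecMulVec z w) ≤ 2 := by
  classical
  refine (Submodule.finrank_mono (t := Submodule.span D (({y, w} : Finset (Fin n → D)) :
    Set (Fin n → D))) ?_).trans ((finrank_span_finset_le_card _).trans Finset.card_le_two)
  rw [Submodule.span_le]
  rintro _ ⟨i, rfl⟩
  simp only [Finset.coe_insert, Finset.coe_singleton]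
  exact Submodule.mem_span_pair.2 ⟨x i, -z i, by ext j; simp [vecMulVec_apply, sub_eq_add_neg]⟩

/-- The difference of two products of a column and a row has rank two exactly when the columns are
right independent and the rows are left independent. -/
lemma mrank_vecMulVec_sub_eq_two_iff {x z : Fin m → D} {y w : Fin n → D} :
    mrank (vecMulVec x y - vecMulVec z w) = 2 ↔
      LinearIndependent Dᵐᵒᵖ ![x, z] ∧ LinearIndependent D ![y, w] := by
  constructor
  · intro h
    have key : ¬ ∃ u v, vecMulVec x y - vecMulVec z w = vecMulVec u v := by
      rw [← mrank_le_one_iff]; omega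
    constructor <;> contrapose! key
    · by_cases hx : x = 0
      · exact ⟨-z, w, by ext i j; simp [hx, vecMulVec_apply]⟩
      · rw [LinearIndependent.pair_iff' hx] at key
        push Not at key
        obtain ⟨d, rfl⟩ := key
        exact ⟨x, y - d.unop • w, by ext i j; simp [vecMulVec_apply, mul_sub, mul_assoc]⟩
    · by_cases hy : y = 0
      · exact ⟨-z, w, by ext i j; simp [hy, vecMulVec_apply]⟩
      · rw [LinearIndependent.pair_iff' hy] at key
        push Not at key
        obtain ⟨d, rfl⟩ := key
        exact ⟨x - MulOpposite.op d • z, y, by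
          ext i j; simp [vecMulVec_apply, sub_mul, mul_assoc]⟩
  · rintro ⟨hxz, hyw⟩
    refine le_antisymm (mrank_vecMulVec_sub_le x z y w) ?_
    by_contra! hlt
    obtain ⟨u, v, huv⟩ := mrank_le_one_iff.1 (Nat.le_of_lt_succ hlt)
    have hrow (i : Fin m) : x i • y - z i • w = u i • v := by
      ext j
      simpa [vecMulVec_apply] using congrFun (congrFun huv i) j
    have hx : x ≠ 0 := hxz.ne_zero 0
    rw [LinearIndependent.pair_iff] at hyw
    obtain ⟨k, hk⟩ : ∃ k, u k ≠ 0 := by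
      by_contra! hu
      refine hx (funext fun i => (hyw (x i) (-z i) ?_).1)
      rw [neg_smul, ← sub_eq_add_neg, hrow, hu, zero_smul]
    have hcoef (i : Fin m) : x i = u i * (u k)⁻¹ * x k ∧ z i = u i * (u k)⁻¹ * z k := by
      have h := hyw (x i - u i * (u k)⁻¹ * x k) (-(z i - u i * (u k)⁻¹ * z k)) (by
        have : (u i * (u k)⁻¹) • (x k • y - z k • w) = u i • v := by
          rw [hrow, smul_smul, inv_mul_cancel_right₀ hk]
        rw [← hrow i, smul_sub, smul_smul, smul_smul] at this
        rw [sub_smul, neg_smul, sub_smul, ← sub_eq_add_neg, sub_sub_sub_comm, this, sub_self])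
      exact ⟨sub_eq_zero.1 h.1, sub_eq_zero.1 (neg_eq_zero.1 h.2)⟩
    have hxk : x k ≠ 0 := by
      intro h
      refine hx (funext fun i => ?_)
      rw [(hcoef i).1, h, mul_zero, Pi.zero_apply]
    refine (LinearIndependent.pair_iff' hx).1 hxz (MulOpposite.op ((x k)⁻¹ * z k)) ?_
    ext i
    rw [Pi.smul_apply, op_smul_eq_mul, (hcoef i).2, (hcoef i).1, mul_assoc _ (x k),
      mul_inv_cancel_left₀ hxk]

lemma exists_linearIndependent_pair {K V ι : Type*} [DivisionRing K] [AddCommGroup V] [Module K V]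
    [Nontrivial V] [Nontrivial ι] {x : ι → V} (hx : x ≠ 0) :
    ∃ z, LinearIndependent K ![x, z] := by
  classical
  obtain ⟨k, hk⟩ := Function.ne_iff.1 hx
  obtain ⟨j, hj⟩ := exists_ne k
  obtain ⟨v, hv⟩ := exists_ne (0 : V)
  refine ⟨Pi.single j v, (LinearIndependent.pair_iff' hx).2 fun a ha => hv ?_⟩
  have h := congrFun ha k
  rw [Pi.single_eq_of_ne hj.symm, Pi.smul_apply, smul_eq_zero_iff_left hk] at h
  have h' := congrFun ha j
  rwa [h, zero_smul, Pi.zero_apply, Pi.single_eq_same, eq_comm] at h'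

/-- The maximal sets through zero: all products of a fixed nonzero column with a row (`true`), or of
a column with a fixed nonzero row (`false`). -/
def Pencil : Bool → Set (Matrix (Fin m) (Fin n) D) → Prop
  | true, S => ∃ x : Fin m → D, x ≠ 0 ∧ S = Set.range fun y : Fin n → D => vecMulVec x y
  | false, S => ∃ y : Fin n → D, y ≠ 0 ∧ S = Set.range fun x : Fin m → D => vecMulVec x y

lemma vecMulVec_mem_range_left {x z : Fin m → D} (hx : x ≠ 0) (w : Fin n → D)
    (h : ¬ LinearIndependent Dᵐᵒᵖ ![x, z]) :
    vecMulVec z w ∈ Set.range fun y : Fin n → D => vecMulVec x y := by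
  rw [LinearIndependent.pair_iff' hx] at h
  push Not at h
  obtain ⟨d, rfl⟩ := h
  exact ⟨d.unop • w, by ext i j; simp [vecMulVec_apply, mul_assoc]⟩

lemma vecMulVec_mem_range_right {y w : Fin n → D} (hy : y ≠ 0) (z : Fin m → D)
    (h : ¬ LinearIndependent D ![y, w]) :
    vecMulVec z w ∈ Set.range fun x : Fin m → D => vecMulVec x y := by
  rw [LinearIndependent.pair_iff' hy] at h
  push Not at h
  obtain ⟨d, rfl⟩ := h
  exact ⟨MulOpposite.op d • z, by ext i j; simp [vecMulVec_apply, mul_assoc]⟩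

lemma linearIndependent_of_range_left_ne {x z : Fin m → D} (hx : x ≠ 0) (hz : z ≠ 0)
    (h : (Set.range fun y : Fin n → D => vecMulVec x y) ≠ Set.range fun y => vecMulVec z y) :
    LinearIndependent Dᵐᵒᵖ ![x, z] := by
  by_contra hd
  refine h (Set.Subset.antisymm ?_ ?_)
  · rintro _ ⟨y, rfl⟩
    exact vecMulVec_mem_range_left hz y fun h => hd (LinearIndependent.pair_symm_iff.1 h)
  · rintro _ ⟨y, rfl⟩
    exact vecMulVec_mem_range_left hx y hd

lemma linearIndependent_of_range_right_ne {y w : Fin n → D} (hy : y ≠ 0) (hw : w ≠ 0)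
    (h : (Set.range fun x : Fin m → D => vecMulVec x y) ≠ Set.range fun x => vecMulVec x w) :
    LinearIndependent D ![y, w] := by
  by_contra hd
  refine h (Set.Subset.antisymm ?_ ?_)
  · rintro _ ⟨x, rfl⟩
    exact vecMulVec_mem_range_right hw x fun h => hd (LinearIndependent.pair_symm_iff.1 h)
  · rintro _ ⟨x, rfl⟩
    exact vecMulVec_mem_range_right hy x hd

lemma not_linearIndependent_self {K V : Type*} [DivisionRing K] [AddCommGroup V] [Module K V]
    (x : V) : ¬ LinearIndependent K ![x, x] := fun h =>
  absurd (h.injective (a₁ := 0) (a₂ := 1) rfl) (by decide)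

lemma vecMulVec_eq_zero_iff {x : Fin m → D} {y : Fin n → D} :
    vecMulVec x y = 0 ↔ x = 0 ∨ y = 0 := by
  simp only [← Matrix.ext_iff, vecMulVec_apply, Matrix.zero_apply, mul_eq_zero, funext_iff,
    Pi.zero_apply, forall_or_left, forall_or_right]

lemma Pencil.zero_mem {t : Bool} {P : Set (Matrix (Fin m) (Fin n) D)} (hP : Pencil t P) :
    0 ∈ P := by
  cases t <;> obtain ⟨x, -, rfl⟩ := hP <;> exact ⟨0, by simp [vecMulVec_eq_zero_iff]⟩

lemma Pencil.mrank_sub_le {t : Bool} {P : Set (Matrix (Fin m) (Fin n) D)} (hP : Pencil t P)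
    {A B : Matrix (Fin m) (Fin n) D} (hA : A ∈ P) (hB : B ∈ P) : mrank (A - B) ≤ 1 := by
  rw [mrank_le_one_iff]
  cases t <;> obtain ⟨x, -, rfl⟩ := hP <;> obtain ⟨a, rfl⟩ := hA <;> obtain ⟨b, rfl⟩ := hB
  · exact ⟨a - b, x, (sub_vecMulVec a b x).symm⟩
  · exact ⟨x, a - b, (vecMulVec_sub x a b).symm⟩

lemma Pencil.exists_ne [Nontrivial (Fin m)] [Nontrivial (Fin n)] {t : Bool}
    {P : Set (Matrix (Fin m) (Fin n) D)} (hP : Pencil t P) :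
    ∃ Q : Set (Matrix (Fin m) (Fin n) D), Pencil t Q ∧ P ≠ Q := by
  cases t <;> obtain ⟨x, hx, rfl⟩ := hP
  · obtain ⟨z, hz⟩ := exists_linearIndependent_pair (K := D) hx
    refine ⟨_, ⟨z, hz.ne_zero 1, rfl⟩, fun h => ?_⟩
    obtain ⟨u, hu⟩ := _root_.exists_ne (0 : Fin m → D)
    obtain ⟨v, hv⟩ := exists_linearIndependent_pair (K := Dᵐᵒᵖ) hu
    have h2 := mrank_vecMulVec_sub_eq_two_iff.2 ⟨hv, hz⟩
    have h1 := Pencil.mrank_sub_le (t := false) ⟨z, hz.ne_zero 1, rfl⟩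
      (h ▸ Set.mem_range_self u) (Set.mem_range_self v)
    omega
  · obtain ⟨z, hz⟩ := exists_linearIndependent_pair (K := Dᵐᵒᵖ) hx
    refine ⟨_, ⟨z, hz.ne_zero 1, rfl⟩, fun h => ?_⟩
    obtain ⟨u, hu⟩ := _root_.exists_ne (0 : Fin n → D)
    obtain ⟨v, hv⟩ := exists_linearIndependent_pair (K := D) hu
    have h2 := mrank_vecMulVec_sub_eq_two_iff.2 ⟨hz, hv⟩
    have h1 := Pencil.mrank_sub_le (t := true) ⟨z, hz.ne_zero 1, rfl⟩
      (h ▸ Set.mem_range_self u) (Set.mem_range_self v)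
    omega

/-- Two distinct pencils of the same type contain adjacent matrices, each of which is at distance two
from some matrix in the other pencil. -/
lemma Pencil.exists_mrank_sub [Nontrivial (Fin m)] [Nontrivial (Fin n)] {t : Bool}
    {P Q : Set (Matrix (Fin m) (Fin n) D)} (hP : Pencil t P) (hQ : Pencil t Q) (hPQ : P ≠ Q) :
    ∃ A ∈ P, ∃ A' ∈ P, ∃ B ∈ Q, ∃ B' ∈ Q,
      mrank (A - B) = 1 ∧ mrank (A - B') = 2 ∧ mrank (A' - B) = 2 := by
  cases t <;> obtain ⟨x, hx, rfl⟩ := hP <;> obtain ⟨z, hz, rfl⟩ := hQ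
  · have hxz := linearIndependent_of_range_right_ne hx hz hPQ
    obtain ⟨u, hu⟩ := _root_.exists_ne (0 : Fin m → D)
    obtain ⟨v, hv⟩ := exists_linearIndependent_pair (K := Dᵐᵒᵖ) hu
    refine ⟨_, ⟨u, rfl⟩, _, ⟨v, rfl⟩, _, ⟨u, rfl⟩, _, ⟨v, rfl⟩, ?_,
      mrank_vecMulVec_sub_eq_two_iff.2 ⟨hv, hxz⟩,
      mrank_vecMulVec_sub_eq_two_iff.2 ⟨LinearIndependent.pair_symm_iff.1 hv, hxz⟩⟩
    refine le_antisymm (mrank_le_one_iff.2 ⟨u, x - z, (vecMulVec_sub u x z).symm⟩)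
      (Nat.one_le_iff_ne_zero.2 fun h => ?_)
    rw [mrank_eq_zero_iff, ← vecMulVec_sub, vecMulVec_eq_zero_iff] at h
    obtain h | h := h
    · exact hu h
    · obtain rfl := sub_eq_zero.1 h
      exact not_linearIndependent_self x hxz
  · have hxz := linearIndependent_of_range_left_ne hx hz hPQ
    obtain ⟨u, hu⟩ := _root_.exists_ne (0 : Fin n → D)
    obtain ⟨v, hv⟩ := exists_linearIndependent_pair (K := D) hu
    refine ⟨_, ⟨u, rfl⟩, _, ⟨v, rfl⟩, _, ⟨u, rfl⟩, _, ⟨v, rfl⟩, ?_,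
      mrank_vecMulVec_sub_eq_two_iff.2 ⟨hxz, hv⟩,
      mrank_vecMulVec_sub_eq_two_iff.2 ⟨hxz, LinearIndependent.pair_symm_iff.1 hv⟩⟩
    refine le_antisymm (mrank_le_one_iff.2 ⟨x - z, u, (sub_vecMulVec x z u).symm⟩)
      (Nat.one_le_iff_ne_zero.2 fun h => ?_)
    rw [mrank_eq_zero_iff, ← sub_vecMulVec, vecMulVec_eq_zero_iff] at h
    obtain h | h := h
    · obtain rfl := sub_eq_zero.1 h
      exact not_linearIndependent_self x hxz
    · exact hu h

lemma Pencil.mrank_sub_eq_two {t : Bool} {P Q : Set (Matrix (Fin m) (Fin n) D)}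
    (hP : Pencil t P) (hQ : Pencil (!t) Q) {A A' B B' : Matrix (Fin m) (Fin n) D}
    (hA : A ∈ P) (hA' : A' ∈ P) (hB : B ∈ Q) (hB' : B' ∈ Q)
    (h : mrank (A - B') = 2) (h' : mrank (A' - B) = 2) : mrank (A - B) = 2 := by
  cases t <;> obtain ⟨x, -, rfl⟩ := hP <;> obtain ⟨y, -, rfl⟩ := hQ <;>
    obtain ⟨a, rfl⟩ := hA <;> obtain ⟨a', rfl⟩ := hA' <;>
    obtain ⟨b, rfl⟩ := hB <;> obtain ⟨b', rfl⟩ := hB' <;>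
    simp only [mrank_vecMulVec_sub_eq_two_iff] at h h' ⊢
  · exact ⟨h.1, h'.2⟩
  · exact ⟨h'.1, h.2⟩

lemma Pencil.eq_of_mem {t : Bool} {P Q : Set (Matrix (Fin m) (Fin n) D)}
    (hP : Pencil t P) (hQ : Pencil t Q) {A : Matrix (Fin m) (Fin n) D} (hA : A ≠ 0)
    (hAP : A ∈ P) (hAQ : A ∈ Q) : P = Q := by
  by_contra hPQ
  cases t <;> obtain ⟨x, hx, rfl⟩ := hP <;> obtain ⟨z, hz, rfl⟩ := hQ <;>
    obtain ⟨a, rfl⟩ := hAP <;> obtain ⟨b, hb⟩ := hAQ <;> refine hA ?_ <;>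
    refine vecMulVec_eq_zero_iff.2 ?_
  · have h := linearIndependent_of_range_right_ne hx hz hPQ
    rw [LinearIndependent.pair_iff] at h
    refine .inl (funext fun i => (h (a i) (-b i) ?_).1)
    ext j
    simpa [vecMulVec_apply, ← sub_eq_add_neg, sub_eq_zero] using (congrFun (congrFun hb i) j).symm
  · have h := linearIndependent_of_range_left_ne hx hz hPQ
    rw [LinearIndependent.pair_iff] at h
    refine .inr (funext fun j => MulOpposite.op_injective
      (h (MulOpposite.op (a j)) (-MulOpposite.op (b j)) ?_).1)
    ext i
    simpa [vecMulVec_apply, ← sub_eq_add_neg, sub_eq_zero] using (congrFun (congrFun hb i) j).symm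

lemma Pencil.exists_ne_zero_mem {t : Bool} {P Q : Set (Matrix (Fin m) (Fin n) D)}
    (hP : Pencil t P) (hQ : Pencil (!t) Q) : ∃ A ≠ 0, A ∈ P ∧ A ∈ Q := by
  cases t <;> obtain ⟨x, hx, rfl⟩ := hP <;> obtain ⟨y, hy, rfl⟩ := hQ
  · exact ⟨vecMulVec y x, by simp [vecMulVec_eq_zero_iff, hx, hy], ⟨y, rfl⟩, ⟨x, rfl⟩⟩
  · exact ⟨vecMulVec x y, by simp [vecMulVec_eq_zero_iff, hx, hy], ⟨y, rfl⟩, ⟨x, rfl⟩⟩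

lemma Pencil.not_pencil_not [Nontrivial (Fin m)] [Nontrivial (Fin n)] {t : Bool}
    {P : Set (Matrix (Fin m) (Fin n) D)} (hP : Pencil t P) : ¬ Pencil (!t) P := by
  intro hP'
  obtain ⟨Q, hQ, hPQ⟩ := hP.exists_ne
  obtain ⟨A, hA, hAQ, hAP⟩ := hQ.exists_ne_zero_mem hP'
  exact hPQ (hP.eq_of_mem hQ hA hAP hAQ)

/-- A clique through zero is contained in a maximal set. -/
lemma exists_pencil_of_mrank_sub_le [Nontrivial (Fin m)]
    {S : Set (Matrix (Fin m) (Fin n) D)} (hn : 0 < n) (h0 : 0 ∈ S)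
    (hS : ∀ A ∈ S, ∀ B ∈ S, mrank (A - B) ≤ 1) : ∃ t P, Pencil t P ∧ S ⊆ P := by
  have : NeZero n := ⟨hn.ne'⟩
  have hmul (A) (hA : A ∈ S) : ∃ x y, A = vecMulVec x y :=
    mrank_le_one_iff.1 (by simpa using hS A hA 0 h0)
  have hdep {x z : Fin m → D} {y w : Fin n → D} (h : vecMulVec x y ∈ S)
      (h' : vecMulVec z w ∈ S) :
      ¬ (LinearIndependent Dᵐᵒᵖ ![x, z] ∧ LinearIndependent D ![y, w]) := by
    rw [← mrank_vecMulVec_sub_eq_two_iff]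
    have := hS _ h _ h'
    omega
  by_cases hS0 : S ⊆ {0}
  · obtain ⟨x, hx⟩ := exists_ne (0 : Fin m → D)
    refine ⟨true, _, ⟨x, hx, rfl⟩, fun A hA => ⟨0, ?_⟩⟩
    simp [Set.mem_singleton_iff.1 (hS0 hA), vecMulVec_eq_zero_iff]
  obtain ⟨A, hA, hA0⟩ := Set.not_subset.1 hS0
  obtain ⟨x, y, rfl⟩ := hmul A hA
  rw [Set.mem_singleton_iff, vecMulVec_eq_zero_iff, not_or] at hA0
  obtain ⟨hx, hy⟩ := hA0
  by_cases hSx : S ⊆ Set.range fun y : Fin n → D => vecMulVec x y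
  · exact ⟨true, _, ⟨x, hx, rfl⟩, hSx⟩
  refine ⟨false, _, ⟨y, hy, rfl⟩, fun C hC => ?_⟩
  obtain ⟨u, v, rfl⟩ := hmul C hC
  obtain ⟨B, hB, hBx⟩ := Set.not_subset.1 hSx
  obtain ⟨z, w, rfl⟩ := hmul B hB
  have hxz : LinearIndependent Dᵐᵒᵖ ![x, z] := by
    by_contra h
    exact hBx (vecMulVec_mem_range_left hx w h)
  have hw : w ≠ 0 := by
    rintro rfl
    exact hBx ⟨0, (vecMulVec_eq_zero_iff.2 (.inr rfl)).trans
      (vecMulVec_eq_zero_iff.2 (.inr rfl)).symm⟩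
  have hyw : ¬ LinearIndependent D ![y, w] := fun h => hdep hA hB ⟨hxz, h⟩
  rw [LinearIndependent.pair_iff' hy] at hyw
  push Not at hyw
  obtain ⟨d, rfl⟩ := hyw
  by_contra hCy
  have hyv : LinearIndependent D ![y, v] := by
    by_contra h
    exact hCy (vecMulVec_mem_range_right hy u h)
  have hxu : ¬ LinearIndependent Dᵐᵒᵖ ![x, u] := fun h => hdep hA hC ⟨h, hyv⟩
  have hzu : ¬ LinearIndependent Dᵐᵒᵖ ![z, u] := fun h => hdep hB hC ⟨h, by
    rw [LinearIndependent.pair_iff' hw]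
    intro a
    rw [smul_smul]
    exact (LinearIndependent.pair_iff' hy).1 hyv _⟩
  rw [LinearIndependent.pair_iff' hx] at hxu
  have hz : z ≠ 0 := hxz.ne_zero 1
  rw [LinearIndependent.pair_iff' hz] at hzu
  push Not at hxu hzu
  obtain ⟨p, hp⟩ := hxu
  obtain ⟨q, hq⟩ := hzu
  have hp0 := (LinearIndependent.pair_iff.1 hxz p (-q) (by
    rw [neg_smul, hp, hq, add_neg_cancel])).1
  rw [hp0, zero_smul] at hp
  exact hCy ⟨0, by simp [← hp]⟩

/-- Every nonzero column is the first column of an invertible matrix. -/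
lemma exists_isUnit_col_eq [NeZero m] {x : Fin m → D} (hx : x ≠ 0) :
    ∃ P : Matrix (Fin m) (Fin m) D, IsUnit P ∧ ∀ i, P i 0 = x i := by
  obtain ⟨k, hk⟩ := Function.ne_iff.1 hx
  rw [Pi.zero_apply] at hk
  set e : Fin m → D := Pi.single k 1 with he
  set T : Matrix (Fin m) (Fin m) D := 1 + vecMulVec (x - e) e with hT
  set T' : Matrix (Fin m) (Fin m) D := 1 - vecMulVec (x - e) ((x k)⁻¹ • e) with hT'
  have hmul : T * T' = 1 := by
    have hdot : e ⬝ᵥ (x - e) = x k - 1 := by simp [he]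
    rw [hT, hT', add_mul, one_mul, mul_sub, mul_one, vecMulVec_mul_vecMulVec, hdot, smul_smul,
      sub_mul, mul_inv_cancel₀ hk, one_mul, sub_smul, one_smul, vecMulVec_sub]
    abel
  refine ⟨T.submatrix id (Equiv.swap 0 k), ?_, fun i => ?_⟩
  · refine IsUnit.of_mul_eq_one (T'.submatrix (Equiv.swap 0 k) id) ?_
    rw [submatrix_mul_equiv, hmul, submatrix_id_id]
  · simp [hT, he, vecMulVec_apply, one_apply, Pi.single_apply]

/-- Every nonzero row is the first row of an invertible matrix. -/
lemma exists_isUnit_row_eq [NeZero n] {y : Fin n → D} (hy : y ≠ 0) :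
    ∃ Q : Matrix (Fin n) (Fin n) D, IsUnit Q ∧ ∀ j, Q 0 j = y j := by
  obtain ⟨P, hP, hPy⟩ := exists_isUnit_col_eq (x := fun j => MulOpposite.op (y j))
    fun h => hy (funext fun j => MulOpposite.op_injective (congrFun h j))
  refine ⟨(RingEquiv.mopMatrix P).unop, (hP.map RingEquiv.mopMatrix).unop, fun j => ?_⟩
  simp [hPy]

/-- The maximal sets of a given type, `true` standing for type one. -/
def IsTypeOf : Bool → Set (Matrix (Fin m) (Fin n) D) → Prop
  | true, S => IsTypeOne S
  | false, S => IsTypeTwo S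

lemma mul_eq_vecMulVec_of_mem_M1set [NeZero m] (P : Matrix (Fin m) (Fin m) D)
    {X : Matrix (Fin m) (Fin n) D} (hX : X ∈ M1set D m n) :
    P * X = vecMulVec (fun i => P i 0) (X 0) := by
  ext i j
  rw [mul_apply, vecMulVec_apply, Finset.sum_eq_single 0]
  · intro k _ hk
    rw [hX k j (Fin.val_ne_zero_iff.2 hk), mul_zero]
  · simp

lemma mul_eq_vecMulVec_of_mem_N1set [NeZero n] (Q : Matrix (Fin n) (Fin n) D)
    {X : Matrix (Fin m) (Fin n) D} (hX : X ∈ N1set D m n) :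
    X * Q = vecMulVec (fun i => X i 0) (Q 0) := by
  ext i j
  rw [mul_apply, vecMulVec_apply, Finset.sum_eq_single 0]
  · intro k _ hk
    rw [hX i k (Fin.val_ne_zero_iff.2 hk), zero_mul]
  · simp

lemma image_mul_M1set [NeZero m] (P : Matrix (Fin m) (Fin m) D) :
    (fun X => P * X) '' M1set D m n =
      Set.range fun y : Fin n → D => vecMulVec (fun i => P i 0) y := by
  apply Set.Subset.antisymm
  · rintro _ ⟨X, hX, rfl⟩
    exact ⟨X 0, (mul_eq_vecMulVec_of_mem_M1set P hX).symm⟩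
  · rintro _ ⟨y, rfl⟩
    have hX : vecMulVec (Pi.single 0 1) y ∈ M1set D m n := fun i j hi => by
      simp [vecMulVec_apply, Fin.val_ne_zero_iff.1 hi]
    refine ⟨_, hX, (mul_eq_vecMulVec_of_mem_M1set P hX).trans ?_⟩
    ext i j
    simp [vecMulVec_apply]

lemma image_mul_N1set [NeZero n] (Q : Matrix (Fin n) (Fin n) D) :
    (fun X => X * Q) '' N1set D m n = Set.range fun x : Fin m → D => vecMulVec x (Q 0) := by
  apply Set.Subset.antisymm
  · rintro _ ⟨X, hX, rfl⟩
    exact ⟨fun i => X i 0, (mul_eq_vecMulVec_of_mem_N1set Q hX).symm⟩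
  · rintro _ ⟨x, rfl⟩
    have hX : vecMulVec x (Pi.single 0 1) ∈ N1set D m n := fun i j hj => by
      simp [vecMulVec_apply, Fin.val_ne_zero_iff.1 hj]
    refine ⟨_, hX, (mul_eq_vecMulVec_of_mem_N1set Q hX).trans ?_⟩
    ext i j
    simp [vecMulVec_apply]

lemma IsTypeOf.exists_pencil_add [NeZero m] [NeZero n] {t : Bool}
    {S : Set (Matrix (Fin m) (Fin n) D)} (hS : IsTypeOf t S) :
    ∃ P A, Pencil t P ∧ S = (· + A) '' P := by
  cases t <;> obtain ⟨P, A, hP, rfl⟩ := hS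
  · refine ⟨_, A, ⟨P 0, fun h => ?_, rfl⟩, by rw [← image_mul_N1set, Set.image_image]⟩
    obtain ⟨R, hR⟩ := hP.exists_right_inv
    have := congrFun (congrFun hR 0) 0
    simp [mul_apply, h] at this
  · refine ⟨_, A, ⟨fun i => P i 0, fun h => ?_, rfl⟩, by rw [← image_mul_M1set, Set.image_image]⟩
    obtain ⟨R, hR⟩ := hP.exists_left_inv
    have := congrFun (congrFun hR 0) 0
    simp [mul_apply, funext_iff.1 h] at this

lemma Pencil.isTypeOf_add [NeZero m] [NeZero n] {t : Bool}
    {P : Set (Matrix (Fin m) (Fin n) D)} (hP : Pencil t P) (A : Matrix (Fin m) (Fin n) D) :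
    IsTypeOf t ((· + A) '' P) := by
  cases t <;> obtain ⟨x, hx, rfl⟩ := hP
  · obtain ⟨Q, hQ, hQx⟩ := exists_isUnit_row_eq hx
    obtain rfl : Q 0 = x := funext hQx
    exact ⟨Q, A, hQ, by rw [← image_mul_N1set, Set.image_image]⟩
  · obtain ⟨Q, hQ, hQx⟩ := exists_isUnit_col_eq hx
    obtain rfl : (fun i => Q i 0) = x := funext hQx
    exact ⟨Q, A, hQ, by rw [← image_mul_M1set, Set.image_image]⟩

lemma Pencil.sub_mem {t : Bool} {P : Set (Matrix (Fin m) (Fin n) D)} (hP : Pencil t P)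
    {A B : Matrix (Fin m) (Fin n) D} (hA : A ∈ P) (hB : B ∈ P) : A - B ∈ P := by
  cases t <;> obtain ⟨x, -, rfl⟩ := hP <;> obtain ⟨a, rfl⟩ := hA <;> obtain ⟨b, rfl⟩ := hB
  · exact ⟨a - b, sub_vecMulVec a b x⟩
  · exact ⟨a - b, vecMulVec_sub x a b⟩

/-- A maximal set is the translate of a pencil by any of its elements. -/
lemma IsTypeOf.exists_pencil [NeZero m] [NeZero n] {t : Bool}
    {S : Set (Matrix (Fin m) (Fin n) D)} (hS : IsTypeOf t S)
    {B : Matrix (Fin m) (Fin n) D} (hB : B ∈ S) :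
    ∃ P, Pencil t P ∧ S = (· + B) '' P := by
  obtain ⟨P, A, hP, rfl⟩ := hS.exists_pencil_add
  obtain ⟨C, hC, rfl⟩ := hB
  refine ⟨P, hP, Set.Subset.antisymm ?_ ?_⟩
  · rintro _ ⟨X, hX, rfl⟩
    exact ⟨X - C, hP.sub_mem hX hC, by simp only; abel⟩
  · rintro _ ⟨X, hX, rfl⟩
    have hX' : X + C ∈ P := by
      simpa using hP.sub_mem hX (hP.sub_mem hP.zero_mem hC)
    exact ⟨X + C, hX', by simp only; abel⟩

lemma IsTypeOf.not_isTypeOf_not [Nontrivial (Fin m)] [Nontrivial (Fin n)] [NeZero m] [NeZero n]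
    {t : Bool} {S : Set (Matrix (Fin m) (Fin n) D)} (hS : IsTypeOf t S) :
    ¬ IsTypeOf (!t) S := by
  intro hS'
  obtain ⟨P, A, hP, rfl⟩ := hS.exists_pencil_add
  obtain ⟨Q, hQ, h⟩ := hS'.exists_pencil ⟨0, hP.zero_mem, rfl⟩
  simp only [zero_add] at h
  rw [(add_left_injective A).image_injective h] at hP
  exact hP.not_pencil_not hQ

section Map

variable {D' : Type} [DivisionRing D'] {m' n' : ℕ}
  {φ : Matrix (Fin m) (Fin n) D → Matrix (Fin m') (Fin n') D'}

lemma exists_pencil_image_subset [Nontrivial (Fin m')] (hn' : 0 < n')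
    (h1 : ∀ X Y, mrank (X - Y) = 1 → mrank (φ X - φ Y) = 1) (h0 : φ 0 = 0)
    {t : Bool} {P : Set (Matrix (Fin m) (Fin n) D)} (hP : Pencil t P) :
    ∃ t' P', Pencil t' P' ∧ φ '' P ⊆ P' := by
  refine exists_pencil_of_mrank_sub_le hn' ⟨0, hP.zero_mem, h0⟩ ?_
  rintro _ ⟨A, hA, rfl⟩ _ ⟨B, hB, rfl⟩
  obtain h | h := Nat.le_one_iff_eq_zero_or_eq_one.1 (hP.mrank_sub_le hA hB)
  · rw [mrank_eq_zero_iff, sub_eq_zero] at h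
    simp [h, mrank_eq_zero_iff.2]
  · exact (h1 A B h).le

variable [Nontrivial (Fin m)] [Nontrivial (Fin n)]

/-- Distinct pencils of the same type are mapped into distinct pencils of the same type. -/
lemma Pencil.image_of_same_type
    (h1 : ∀ X Y, mrank (X - Y) = 1 → mrank (φ X - φ Y) = 1)
    (h2 : ∀ X Y, mrank (X - Y) = 2 → mrank (φ X - φ Y) = 2)
    {t s' t' : Bool} {P Q : Set (Matrix (Fin m) (Fin n) D)}
    {P' Q' : Set (Matrix (Fin m') (Fin n') D')} (hP : Pencil t P) (hQ : Pencil t Q) (hPQ : P ≠ Q)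
    (hP' : Pencil s' P') (hQ' : Pencil t' Q') (hPP' : φ '' P ⊆ P') (hQQ' : φ '' Q ⊆ Q') :
    s' = t' ∧ P' ≠ Q' := by
  obtain ⟨A, hA, A', hA', B, hB, B', hB', hAB, hAB', hA'B⟩ := hP.exists_mrank_sub hQ hPQ
  have mP {X} (hX : X ∈ P) : φ X ∈ P' := hPP' (Set.mem_image_of_mem φ hX)
  have mQ {X} (hX : X ∈ Q) : φ X ∈ Q' := hQQ' (Set.mem_image_of_mem φ hX)
  constructor
  · by_contra hst
    obtain rfl := Bool.eq_not_of_ne (Ne.symm hst)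
    have := hP'.mrank_sub_eq_two hQ' (mP hA) (mP hA') (mQ hB) (mQ hB') (h2 _ _ hAB')
      (h2 _ _ hA'B)
    have := h1 _ _ hAB
    omega
  · rintro rfl
    have := hP'.mrank_sub_le (mP hA) (mQ hB')
    have := h2 _ _ hAB'
    omega

/-- Pencils of different types are mapped into pencils of different types. -/
lemma Pencil.image_of_different_type [Nontrivial (Fin m')] (hn' : 0 < n')
    (h1 : ∀ X Y, mrank (X - Y) = 1 → mrank (φ X - φ Y) = 1)
    (h2 : ∀ X Y, mrank (X - Y) = 2 → mrank (φ X - φ Y) = 2) (h0 : φ 0 = 0)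
    {t s' t' : Bool} {P Q : Set (Matrix (Fin m) (Fin n) D)}
    {P' Q' : Set (Matrix (Fin m') (Fin n') D')} (hP : Pencil t P) (hQ : Pencil (!t) Q)
    (hP' : Pencil s' P') (hQ' : Pencil t' Q') (hPP' : φ '' P ⊆ P') (hQQ' : φ '' Q ⊆ Q') :
    s' ≠ t' := by
  rintro rfl
  have heq {R R'} (hR : Pencil t R) (hR' : Pencil s' R') (hRR' : φ '' R ⊆ R') : R' = Q' := by
    obtain ⟨A, hA, hAR, hAQ⟩ := hR.exists_ne_zero_mem hQ
    refine hR'.eq_of_mem hQ' (fun h => ?_) (hRR' ⟨A, hAR, rfl⟩) (hQQ' ⟨A, hAQ, rfl⟩)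
    have hle : mrank (A - 0) ≤ 1 := hR.mrank_sub_le hAR hR.zero_mem
    have hne : mrank (A - 0) ≠ 0 := by simpa [mrank_eq_zero_iff] using hA
    have := h1 A 0 (by omega)
    rw [h, h0, sub_zero, mrank_eq_zero_iff.2 rfl] at this
    omega
  obtain ⟨R, hR, hPR⟩ := hP.exists_ne
  obtain ⟨r', R', hR', hRR'⟩ := exists_pencil_image_subset hn' h1 h0 hR
  obtain ⟨rfl, hne⟩ := hP.image_of_same_type h1 h2 hR hPR hP' hR' hPP' hRR'
  exact hne ((heq hP hP' hPP').trans (heq hR hR' hRR').symm)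

end Map

end

/-- Corollary 3.8: a map preserving distances 1 and 2 with `φ(0) = 0` maps distinct maximal
sets of the same type (resp. different types) into distinct maximal sets of the same type
(resp. different types). -/
theorem distance_one_two_preserving_maximal_sets
    {D D' : Type} [DivisionRing D] [DivisionRing D'] {m n m' n' : ℕ}
    (hm : 2 ≤ m) (hn : 2 ≤ n) (hm' : 2 ≤ m') (hn' : 2 ≤ n')
    (φ : Matrix (Fin m) (Fin n) D → Matrix (Fin m') (Fin n') D')
    (h1 : ∀ X Y, mrank (X - Y) = 1 → mrank (φ X - φ Y) = 1)
    (h2 : ∀ X Y, mrank (X - Y) = 2 → mrank (φ X - φ Y) = 2)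
    (h0 : φ 0 = 0)
    (M N : Set (Matrix (Fin m) (Fin n) D))
    (hMmax : IsTypeOne M ∨ IsTypeTwo M) (hNmax : IsTypeOne N ∨ IsTypeTwo N) (hMN : M ≠ N)
    (h0M : (0 : Matrix (Fin m) (Fin n) D) ∈ M) (hne : (M ∩ N).Nonempty) :
    ∃ M' N' : Set (Matrix (Fin m') (Fin n') D'),
      (IsTypeOne M' ∨ IsTypeTwo M') ∧ (IsTypeOne N' ∨ IsTypeTwo N') ∧ M' ≠ N' ∧
      φ '' M ⊆ M' ∧ φ '' N ⊆ N' ∧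
      (((IsTypeOne M ∧ IsTypeOne N) ∨ (IsTypeTwo M ∧ IsTypeTwo N)) →
        ((IsTypeOne M' ∧ IsTypeOne N') ∨ (IsTypeTwo M' ∧ IsTypeTwo N'))) ∧
      (((IsTypeOne M ∧ IsTypeTwo N) ∨ (IsTypeTwo M ∧ IsTypeOne N)) →
        ((IsTypeOne M' ∧ IsTypeTwo N') ∨ (IsTypeTwo M' ∧ IsTypeOne N'))) := by
  have : NeZero m := ⟨by omega⟩
  have : NeZero n := ⟨by omega⟩
  have : NeZero m' := ⟨by omega⟩
  have : NeZero n' := ⟨by omega⟩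
  have : Nontrivial (Fin m) := Fin.nontrivial_iff_two_le.2 hm
  have : Nontrivial (Fin n) := Fin.nontrivial_iff_two_le.2 hn
  have : Nontrivial (Fin m') := Fin.nontrivial_iff_two_le.2 hm'
  have : Nontrivial (Fin n') := Fin.nontrivial_iff_two_le.2 hn'
  obtain ⟨s, hM⟩ : ∃ s, IsTypeOf s M := hMmax.elim (⟨true, ·⟩) (⟨false, ·⟩)
  obtain ⟨t, hN⟩ : ∃ t, IsTypeOf t N := hNmax.elim (⟨true, ·⟩) (⟨false, ·⟩)
  obtain ⟨B, hBM, hBN⟩ := hne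
  obtain ⟨P, hP, rfl⟩ := hM.exists_pencil hBM
  obtain ⟨Q, hQ, rfl⟩ := hN.exists_pencil hBN
  set ψ : Matrix (Fin m) (Fin n) D → Matrix (Fin m') (Fin n') D' :=
    fun X => φ (X + B) - φ B with hψ
  have ψ0 : ψ 0 = 0 := by simp [hψ]
  have ψ1 : ∀ X Y, mrank (X - Y) = 1 → mrank (ψ X - ψ Y) = 1 := fun X Y h => by
    simpa [hψ] using h1 (X + B) (Y + B) (by simpa using h)
  have ψ2 : ∀ X Y, mrank (X - Y) = 2 → mrank (ψ X - ψ Y) = 2 := fun X Y h => by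
    simpa [hψ] using h2 (X + B) (Y + B) (by simpa using h)
  obtain ⟨s', P', hP', hPP'⟩ := exists_pencil_image_subset (by omega) ψ1 ψ0 hP
  obtain ⟨t', Q', hQ', hQQ'⟩ := exists_pencil_image_subset (by omega) ψ1 ψ0 hQ
  have hPQ : P ≠ Q := by
    rintro rfl
    exact hMN rfl
  have key : (s = t ↔ s' = t') ∧ P' ≠ Q' := by
    by_cases hst : s = t
    · subst hst
      have := hP.image_of_same_type ψ1 ψ2 hQ hPQ hP' hQ' hPP' hQQ'
      exact ⟨iff_of_true rfl this.1, this.2⟩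
    · obtain rfl := Bool.eq_not_of_ne (Ne.symm hst)
      have hst' := hP.image_of_different_type (by omega) ψ1 ψ2 ψ0 hQ hP' hQ' hPP' hQQ'
      refine ⟨iff_of_false hst hst', ?_⟩
      rintro rfl
      obtain rfl := Bool.eq_not_of_ne (Ne.symm hst')
      exact hP'.not_pencil_not hQ'
  have image_subset {R : Set (Matrix (Fin m) (Fin n) D)} {R' : Set (Matrix (Fin m') (Fin n') D')}
      (h : ψ '' R ⊆ R') : φ '' ((· + B) '' R) ⊆ (· + φ B) '' R' := by
    rintro _ ⟨_, ⟨X, hX, rfl⟩, rfl⟩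
    exact ⟨ψ X, h ⟨X, hX, rfl⟩, by simp [hψ]⟩
  have hM' := hP'.isTypeOf_add (φ B)
  have hN' := hQ'.isTypeOf_add (φ B)
  have hM1 := hM.not_isTypeOf_not
  have hN1 := hN.not_isTypeOf_not
  refine ⟨_, _, ?_, ?_, fun h => key.2 ((add_left_injective (φ B)).image_injective h),
    image_subset hPP', image_subset hQQ', ?_⟩
  · cases s' <;> simp_all [IsTypeOf]
  · cases t' <;> simp_all [IsTypeOf]
  · have key := key.1
    clear_value ψ
    cases s <;> cases t <;> cases s' <;> cases t' <;> simp only [IsTypeOf] at * <;> tauto
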